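/- Let F ⊆ Sym²(ℝⁿ) be a complete convex cone subequation with edge E = F ∩ (−F), polar cone F₊, and dual span S = span(F₊). Then the following are equivalent: (i) F = E + 𝒫, i.e., F is the minimal subequation with edge E; (ii) Int F = E + Int 𝒫; (iii) F₊ = S ∩ 𝒫. -/

import Mathlib

open Matrix Set Pointwise

noncomputable section

/-- `Sym²(ℝⁿ)`: the space of real symmetric `n × n` matrices,
realized as the self-adjoint elements of the matrix algebra. -/
abbrev SymMat (n : ℕ) : Type := ↥(selfAdjoint (Matrix (Fin n) (Fin n) ℝ))

namespace SymMat

variable {n : ℕ}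

/-- The trace inner product `⟨A, B⟩ = tr (A * B)` on `Sym²(ℝⁿ)`. -/
def tinner (A B : SymMat n) : ℝ :=
  ((A : Matrix (Fin n) (Fin n) ℝ) * (B : Matrix (Fin n) (Fin n) ℝ)).trace

/-- `𝒫`: the closed convex cone of positive semidefinite matrices. -/
def Psd (n : ℕ) : Set (SymMat n) :=
  {A | (A : Matrix (Fin n) (Fin n) ℝ).PosSemidef}

/-- The set of positive definite matrices (= `Int 𝒫`). -/
def Pd (n : ℕ) : Set (SymMat n) :=
  {A | (A : Matrix (Fin n) (Fin n) ℝ).PosDef}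

/-- A convex cone subequation: a closed convex cone `F ⊆ Sym²(ℝⁿ)` which is a nonempty
proper subset and satisfies the positivity condition `F + 𝒫 = F`. -/
structure IsSubequation (F : Set (SymMat n)) : Prop where
  nonempty : F.Nonempty
  proper : F ≠ Set.univ
  isClosed : IsClosed F
  convex : Convex ℝ F
  cone : ∀ t : ℝ, 0 ≤ t → ∀ A ∈ F, t • A ∈ F
  positivity : ∀ A ∈ F, ∀ P ∈ Psd n, A + P ∈ F

/-- The polar cone `F₊ = {B : ⟨A,B⟩ ≥ 0 ∀ A ∈ F}`. -/
def polarCone (F : Set (SymMat n)) : Set (SymMat n) :=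
  {B | ∀ A ∈ F, 0 ≤ tinner A B}

/-- The edge `E = F ∩ (−F)`. -/
def edge (F : Set (SymMat n)) : Set (SymMat n) := F ∩ (-F)

/-- Orthogonal complement (as a set) with respect to the trace inner product. -/
def orthSet (E : Set (SymMat n)) : Set (SymMat n) :=
  {B | ∀ A ∈ E, tinner A B = 0}

/-- `P_e = e eᵀ`, orthogonal projection onto the line spanned by `e`, as a symmetric matrix. -/
def lineProj (e : EuclideanSpace ℝ (Fin n)) : SymMat n :=
  ⟨Matrix.vecMulVec (WithLp.equiv 2 (Fin n → ℝ) e) (WithLp.equiv 2 (Fin n → ℝ) e), by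
    refine selfAdjoint.mem_iff.mpr ?_
    ext i j
    simp [Matrix.conjTranspose_apply, Matrix.vecMulVec_apply, mul_comm]⟩

/-- The matrix `P_W` of the orthogonal projection onto a subspace `W ⊆ ℝⁿ`. -/
def projMat (W : Submodule ℝ (EuclideanSpace ℝ (Fin n))) : Matrix (Fin n) (Fin n) ℝ :=
  Matrix.toEuclideanLin.symm ((W.subtypeL.comp W.orthogonalProjectionOnto).toLinearMap)

/-- `Sym²(W) = {A : A = P_W A P_W}`. -/
def symOn (W : Submodule ℝ (EuclideanSpace ℝ (Fin n))) : Set (SymMat n) :=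
  {A | (A : Matrix (Fin n) (Fin n) ℝ) = projMat W * A * projMat W}

/-- The restriction `F_W = {P_W A P_W : A ∈ F}` of `F` to `W` (inside `Sym²(W)`). -/
def restrictTo (F : Set (SymMat n)) (W : Submodule ℝ (EuclideanSpace ℝ (Fin n))) :
    Set (SymMat n) :=
  {B | ∃ A ∈ F, (B : Matrix (Fin n) (Fin n) ℝ) = projMat W * A * projMat W}

/-- `F` is extremely degenerate: the polar cone only involves the variables of some
proper subspace `W ⊊ ℝⁿ`. -/
def IsExtremelyDegenerate (F : Set (SymMat n)) : Prop :=
  ∃ W : Submodule ℝ (EuclideanSpace ℝ (Fin n)), W ≠ ⊤ ∧ polarCone F ⊆ symOn W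

/-- `F` is (dimensionally) complete. -/
def IsComplete (F : Set (SymMat n)) : Prop := ¬ IsExtremelyDegenerate F

/-- The interior of `F` relative to `S`. -/
def relInt (S F : Set (SymMat n)) : Set (SymMat n) :=
  {B | B ∈ S ∧ ∃ U : Set (SymMat n), IsOpen U ∧ B ∈ U ∧ U ∩ S ⊆ F}

/-- The support of `F`: the intersection of all subspaces `W'` with `F₊ ⊆ Sym²(W')`. -/
def support (F : Set (SymMat n)) : Submodule ℝ (EuclideanSpace ℝ (Fin n)) :=
  sInf {W | polarCone F ⊆ symOn W}

/-- The polar cone of `G` taken within `Sym²(W)`. -/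
def polarIn (G : Set (SymMat n)) (W : Submodule ℝ (EuclideanSpace ℝ (Fin n))) :
    Set (SymMat n) :=
  {B | B ∈ symOn W ∧ ∀ A ∈ G, 0 ≤ tinner A B}

end SymMat


namespace SymMat

variable {n : ℕ}

lemma symm_entry (A : SymMat n) (i j : Fin n) :
    (A : Matrix (Fin n) (Fin n) ℝ) i j = (A : Matrix (Fin n) (Fin n) ℝ) j i := by
  have h : star (A : Matrix (Fin n) (Fin n) ℝ) = A := selfAdjoint.mem_iff.1 A.2
  exact (congrFun (congrFun h i) j).symm

lemma isHerm (A : SymMat n) : (A : Matrix (Fin n) (Fin n) ℝ).IsHermitian := A.2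

/-- The inclusion into the coordinate space. -/
def incl (n : ℕ) : SymMat n →ₗ[ℝ] (Fin n → Fin n → ℝ) where
  toFun A := fun i j => (A : Matrix (Fin n) (Fin n) ℝ) i j
  map_add' _ _ := rfl
  map_smul' _ _ := rfl

lemma incl_inj : Function.Injective (incl n) := by
  intro A B h
  apply Subtype.ext
  exact h

lemma incl_inducing : Topology.IsInducing (incl n) := ⟨rfl⟩

instance : ContinuousSMul ℝ (SymMat n) := by
  constructor
  rw [incl_inducing.continuous_iff]
  have h : Continuous fun p : ℝ × SymMat n => p.1 • incl n p.2 :=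
    continuous_fst.smul (incl_inducing.continuous.comp continuous_snd)
  exact h

instance : LocallyConvexSpace ℝ (SymMat n) :=
  LocallyConvexSpace.induced (incl n)

instance : FiniteDimensional ℝ (SymMat n) :=
  FiniteDimensional.of_injective (incl n) incl_inj

lemma incl_closedEmbedding : Topology.IsClosedEmbedding (incl n) where
  toIsInducing := incl_inducing
  injective := incl_inj
  isClosed_range := by
    have : range (incl n) = {f | ∀ i j, f i j = f j i} := by
      ext f
      constructor
      · rintro ⟨A, rfl⟩ i j
        exact symm_entry A i j
      · intro h
        refine ⟨⟨Matrix.of f, selfAdjoint.mem_iff.2 ?_⟩, rfl⟩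
        ext i j
        exact h j i
    rw [this]
    simp only [ofPred_forall]
    exact isClosed_iInter fun i => isClosed_iInter fun j =>
      isClosed_eq (by fun_prop) (by fun_prop)

lemma continuous_entry (i j : Fin n) :
    Continuous fun A : SymMat n => (A : Matrix (Fin n) (Fin n) ℝ) i j :=
  (continuous_apply j).comp ((continuous_apply i).comp incl_inducing.continuous)

/-- The trace form as a bilinear map. -/
def tbil (n : ℕ) : SymMat n →ₗ[ℝ] SymMat n →ₗ[ℝ] ℝ :=
  LinearMap.mk₂ ℝ tinner
    (by intro a b c; simp [tinner, add_mul])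
    (by intro a b c; simp [tinner])
    (by intro a b c; simp [tinner, mul_add])
    (by intro a b c; simp [tinner])

lemma tbil_apply (A B : SymMat n) : tbil n A B = tinner A B := rfl

lemma tinner_comm (A B : SymMat n) : tinner A B = tinner B A := Matrix.trace_mul_comm _ _

lemma tbil_inj : Function.Injective (tbil n) := by
  rw [← LinearMap.ker_eq_bot, LinearMap.ker_eq_bot']
  intro A h
  have h1 : tinner A A = 0 := by rw [← tbil_apply, h]; rfl
  have h2 : ((A : Matrix (Fin n) (Fin n) ℝ)ᴴ * (A : Matrix (Fin n) (Fin n) ℝ)).trace = 0 := by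
    rw [(isHerm A).eq]; exact h1
  exact Subtype.ext (Matrix.trace_conjTranspose_mul_self_eq_zero_iff.1 h2)

lemma exists_rep (f : SymMat n →ₗ[ℝ] ℝ) : ∃ B : SymMat n, ∀ A, f A = tinner A B := by
  have hs : Function.Surjective (tbil n) :=
    (LinearMap.injective_iff_surjective_of_finrank_eq_finrank
      (Subspace.dual_finrank_eq (K := ℝ) (V := SymMat n)).symm).1 tbil_inj
  obtain ⟨B, hB⟩ := hs f
  refine ⟨B, fun A => ?_⟩
  rw [← hB, tbil_apply, tinner_comm]

/-- Separation of a point from a closed convex cone. -/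
lemma separate {C : Set (SymMat n)} (hne : C.Nonempty) (hcl : IsClosed C) (hcv : Convex ℝ C)
    (hcone : ∀ t : ℝ, 0 ≤ t → ∀ A ∈ C, t • A ∈ C) {A : SymMat n} (hA : A ∉ C) :
    ∃ B ∈ polarCone C, tinner A B < 0 := by
  obtain ⟨f, u, h1, h2⟩ := geometric_hahn_banach_point_closed hcv hcl hA
  obtain ⟨B, hB⟩ := exists_rep (f : SymMat n →ₗ[ℝ] ℝ)
  have hB' : ∀ A, f A = tinner A B := hB
  obtain ⟨C0, hC0⟩ := hne
  have hu : u < 0 := by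
    have := h2 _ (hcone 0 le_rfl C0 hC0)
    simpa using this
  refine ⟨B, fun D hD => ?_, ?_⟩
  · rw [← hB']
    by_contra! hneg
    have := h2 _ (hcone (u / f D) (div_nonneg_of_nonpos hu.le hneg.le) D hD)
    rw [map_smul, smul_eq_mul, div_mul_cancel₀ _ hneg.ne] at this
    exact lt_irrefl _ this
  · rw [← hB']; linarith

lemma psd_factor {A : Matrix (Fin n) (Fin n) ℝ} (hA : A.PosSemidef) :
    ∃ C : Matrix (Fin n) (Fin n) ℝ, A = Cᴴ * C := by
  open scoped MatrixOrder Matrix.Norms.L2Operator in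
  obtain ⟨B, rfl⟩ := CStarAlgebra.nonneg_iff_eq_star_mul_self.mp hA.nonneg
  exact ⟨B, rfl⟩

lemma trace_mul_psd {A B : Matrix (Fin n) (Fin n) ℝ} (hA : A.PosSemidef) (hB : B.PosSemidef) :
    0 ≤ (A * B).trace ∧ ((A * B).trace = 0 → B * A = 0) := by
  obtain ⟨C, rfl⟩ := psd_factor hA
  have hp : (C * B * Cᴴ).PosSemidef := hB.mul_mul_conjTranspose_same C
  have ht : (Cᴴ * C * B).trace = (C * B * Cᴴ).trace := by
    rw [Matrix.mul_assoc, Matrix.trace_mul_comm]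
  rw [ht]
  refine ⟨hp.trace_nonneg, fun h0 => ?_⟩
  rw [hp.trace_eq_zero_iff] at h0
  obtain ⟨D, rfl⟩ := psd_factor hB
  have h1 : D * Cᴴ = 0 := by
    rw [← Matrix.conjTranspose_mul_self_eq_zero, conjTranspose_mul, conjTranspose_conjTranspose]
    simpa only [Matrix.mul_assoc] using h0
  rw [Matrix.mul_assoc, ← Matrix.mul_assoc D, h1]; simp

lemma mem_psd {A : SymMat n} :
    A ∈ Psd n ↔ ∀ x : Fin n → ℝ, 0 ≤ x ⬝ᵥ ((A : Matrix (Fin n) (Fin n) ℝ) *ᵥ x) := by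
  constructor
  · intro h x
    simpa using Matrix.PosSemidef.dotProduct_mulVec_nonneg h x
  · intro h
    exact .of_dotProduct_mulVec_nonneg (isHerm A) (by simpa using h)

lemma tinner_lineProj (e : EuclideanSpace ℝ (Fin n)) (B : SymMat n) :
    tinner (lineProj e) B = e.ofLp ⬝ᵥ ((B : Matrix (Fin n) (Fin n) ℝ) *ᵥ e.ofLp) := by
  rw [tinner_comm]
  simp only [tinner, lineProj, WithLp.equiv_apply]
  rw [Matrix.mul_vecMulVec, Matrix.trace_vecMulVec, dotProduct_comm]

lemma lineProj_mem (e : EuclideanSpace ℝ (Fin n)) : lineProj e ∈ Psd n := by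
  have := Matrix.posSemidef_vecMulVec_self_star e.ofLp
  simpa [Psd, lineProj] using this

lemma psd_zero : (0 : SymMat n) ∈ Psd n := Matrix.PosSemidef.zero

lemma psd_add {A B : SymMat n} (hA : A ∈ Psd n) (hB : B ∈ Psd n) : A + B ∈ Psd n :=
  Matrix.PosSemidef.add hA hB

lemma psd_smul {A : SymMat n} (hA : A ∈ Psd n) {t : ℝ} (ht : 0 ≤ t) : t • A ∈ Psd n :=
  Matrix.PosSemidef.smul hA ht

lemma psd_convex : Convex ℝ (Psd n) := fun _ hA _ hB _ _ ha hb _ =>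
  psd_add (psd_smul hA ha) (psd_smul hB hb)

lemma psd_closed : IsClosed (Psd n) := by
  have : Psd n = ⋂ x : Fin n → ℝ, {A : SymMat n | 0 ≤ x ⬝ᵥ ((A : Matrix (Fin n) (Fin n) ℝ) *ᵥ x)} := by
    ext A; simp [mem_psd]
  rw [this]
  refine isClosed_iInter fun x => isClosed_le continuous_const ?_
  exact continuous_const.dotProduct (continuous_subtype_val.matrix_mulVec continuous_const)

/-- The trace as a linear functional. -/
def tr (A : SymMat n) : ℝ := (A : Matrix (Fin n) (Fin n) ℝ).trace

lemma tr_cont : Continuous (tr (n := n)) := continuous_subtype_val.matrix_trace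

lemma entry_bound {A : SymMat n} (hA : A ∈ Psd n) (i j : Fin n) :
    |(A : Matrix (Fin n) (Fin n) ℝ) i j| ≤ tr A := by
  have hd : ∀ k, 0 ≤ (A : Matrix (Fin n) (Fin n) ℝ) k k := fun k =>
    Matrix.PosSemidef.diag_nonneg hA
  have hk : ∀ k, (A : Matrix (Fin n) (Fin n) ℝ) k k ≤ tr A := fun k =>
    Finset.single_le_sum (f := fun k => (A : Matrix (Fin n) (Fin n) ℝ) k k)
      (fun k _ => hd k) (Finset.mem_univ k)
  have h1 := mem_psd.1 hA (Pi.single i 1 + Pi.single j 1)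
  have h2 := mem_psd.1 hA (Pi.single i 1 - Pi.single j 1)
  simp [Matrix.mulVec_add, Matrix.mulVec_sub, add_dotProduct, sub_dotProduct] at h1 h2
  have h3 := symm_entry A i j
  rw [abs_le]
  constructor <;> linarith [hk i, hk j]

lemma psd_compact (M : ℝ) : IsCompact (Psd n ∩ {A | tr A ≤ M}) := by
  have hc : IsCompact ((incl n) ⁻¹' (Set.pi univ fun _ => Set.pi univ fun _ => Icc (-M) M)) :=
    incl_closedEmbedding.isCompact_preimage
      (isCompact_univ_pi fun _ => isCompact_univ_pi fun _ => isCompact_Icc)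
  refine hc.of_isClosed_subset (psd_closed.inter (isClosed_le tr_cont continuous_const)) ?_
  rintro A ⟨hA, hM⟩ i _ j _
  have := abs_le.1 ((entry_bound hA i j).trans hM)
  exact ⟨this.1, this.2⟩

lemma tr_nonneg {A : SymMat n} (hA : A ∈ Psd n) : 0 ≤ tr A := Matrix.PosSemidef.trace_nonneg hA

lemma tr_eq_zero {A : SymMat n} (hA : A ∈ Psd n) (h : tr A = 0) : A = 0 :=
  Subtype.ext ((Matrix.PosSemidef.trace_eq_zero_iff hA).1 h)

lemma tr_smul (t : ℝ) (A : SymMat n) : tr (t • A) = t * tr A := by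
  simp [tr]

lemma tr_add (A B : SymMat n) : tr (A + B) = tr A + tr B := by
  simp [tr]

/-- Closedness of `E + 𝒫` when `E ∩ 𝒫 = 0`. -/
lemma closed_add (E : Submodule ℝ (SymMat n)) (h0 : ∀ A ∈ E, A ∈ Psd n → A = 0) :
    IsClosed ((E : Set (SymMat n)) + Psd n) := by
  have hEc : IsClosed (E : Set (SymMat n)) := E.closed_of_finiteDimensional
  have hK : IsCompact (Psd n ∩ {A | tr A = 1}) :=
    (psd_compact 1).of_isClosed_subset
      (psd_closed.inter (isClosed_eq tr_cont continuous_const))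
      (fun A hA => ⟨hA.1, le_of_eq hA.2⟩)
  have hKc : Convex ℝ (Psd n ∩ {A | tr A = 1}) := by
    refine psd_convex.inter ?_
    intro A hA B hB a b _ _ hab
    simp only [mem_ofPred_eq] at *
    rw [tr_add, tr_smul, tr_smul, hA, hB]; linarith
  have hd : Disjoint (Psd n ∩ {A | tr A = 1}) (E : Set (SymMat n)) := by
    rw [Set.disjoint_left]
    rintro A ⟨hA, hA1⟩ hE
    have := h0 A hE hA
    subst this
    simp [tr] at hA1
  obtain ⟨f, u, v, hu, huv, hv⟩ := geometric_hahn_banach_compact_closed hKc hK E.convex hEc hd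
  have hv0 : v < 0 := by simpa using hv 0 E.zero_mem
  have hfE : ∀ e ∈ E, f e = 0 := by
    intro e he
    by_contra hne
    have := hv _ (E.smul_mem (v / f e) he)
    rw [map_smul, smul_eq_mul, div_mul_cancel₀ _ hne] at this
    exact lt_irrefl _ this
  have hfP : ∀ p ∈ Psd n, f p ≤ u * tr p := by
    intro p hp
    rcases (tr_nonneg hp).eq_or_lt with h | h
    · rw [tr_eq_zero hp h.symm]; simp [tr]
    · have := hu ((tr p)⁻¹ • p) ⟨psd_smul hp (by positivity), by
        simp only [mem_ofPred_eq]; rw [tr_smul, inv_mul_cancel₀ h.ne']⟩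
      rw [map_smul, smul_eq_mul, inv_mul_lt_iff₀ h] at this
      linarith
  refine isClosed_of_closure_subset fun A hA => ?_
  set M : ℝ := (f A - 1) / u with hM
  have hcl : IsClosed ((E : Set (SymMat n)) + (Psd n ∩ {A | tr A ≤ M})) :=
    hEc.add_right_of_isCompact (psd_compact M)
  have hU : IsOpen {B : SymMat n | f A - 1 < f B} := isOpen_lt continuous_const f.continuous
  have hA2 : A ∈ closure ({B : SymMat n | f A - 1 < f B} ∩ ((E : Set (SymMat n)) + Psd n)) :=
    hU.inter_closure ⟨by simp, hA⟩
  have hsub : {B : SymMat n | f A - 1 < f B} ∩ ((E : Set (SymMat n)) + Psd n) ⊆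
      (E : Set (SymMat n)) + (Psd n ∩ {A | tr A ≤ M}) := by
    rintro B ⟨hB, e, he, p, hp, rfl⟩
    refine ⟨e, he, p, ⟨hp, ?_⟩, rfl⟩
    have h1 : f A - 1 < f (e + p) := hB
    rw [map_add, hfE e he] at h1
    have h2 := hfP p hp
    simp only [mem_ofPred_eq]
    rw [hM, le_div_iff_of_neg (by linarith)]
    linarith
  obtain ⟨e, he, p, hp, h⟩ := closure_minimal hsub hcl hA2
  exact ⟨e, he, p, hp.1, h⟩

/-- The identity matrix. -/
def idm (n : ℕ) : SymMat n := 1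

lemma idm_mem_interior : idm n ∈ interior (Psd n) := by
  rw [mem_interior_iff_mem_nhds]
  have hn : (0 : ℝ) < 1 / (n + 1) := by positivity
  have hev : ∀ᶠ A : SymMat n in nhds (idm n), ∀ i j,
      |(A : Matrix (Fin n) (Fin n) ℝ) i j - (1 : Matrix (Fin n) (Fin n) ℝ) i j| < 1 / (n + 1) := by
    rw [Filter.eventually_all]; intro i
    rw [Filter.eventually_all]; intro j
    have hc : Continuous fun A : SymMat n =>
        |(A : Matrix (Fin n) (Fin n) ℝ) i j - (1 : Matrix (Fin n) (Fin n) ℝ) i j| :=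
      ((continuous_entry i j).sub continuous_const).abs
    refine hc.tendsto _ |>.eventually_lt_const ?_
    simpa [idm] using hn
  filter_upwards [hev] with A hA
  rw [mem_psd]
  intro x
  set D : Matrix (Fin n) (Fin n) ℝ := (A : Matrix (Fin n) (Fin n) ℝ) - 1 with hD
  have hAD : (A : Matrix (Fin n) (Fin n) ℝ) = 1 + D := by rw [hD]; abel
  rw [hAD, Matrix.add_mulVec, dotProduct_add, Matrix.one_mulVec]
  have hterm : ∀ i j, -(1 / (n + 1 : ℝ) * ((x i ^ 2 + x j ^ 2) / 2)) ≤ x i * (D i j * x j) := by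
    intro i j
    have h1 : |D i j| ≤ 1 / (n + 1) := (hA i j).le
    have h2 : |x i * (D i j * x j)| ≤ 1 / (n + 1 : ℝ) * ((x i ^ 2 + x j ^ 2) / 2) := by
      have : |x i * (D i j * x j)| = |D i j| * (|x i| * |x j|) := by
        rw [abs_mul, abs_mul]; ring
      rw [this]
      refine mul_le_mul h1 ?_ (by positivity) hn.le
      nlinarith [sq_nonneg (|x i| - |x j|), sq_abs (x i), sq_abs (x j)]
    exact (abs_le.1 h2).1
  have hsum : ∑ i, ∑ j, -(1 / (n + 1 : ℝ) * ((x i ^ 2 + x j ^ 2) / 2)) ≤ x ⬝ᵥ (D *ᵥ x) := by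
    simp only [dotProduct, Matrix.mulVec, Finset.mul_sum]
    exact Finset.sum_le_sum fun i _ => Finset.sum_le_sum fun j _ => hterm i j
  have hs : ∑ i, ∑ j, -(1 / (n + 1 : ℝ) * ((x i ^ 2 + x j ^ 2) / 2)) =
      -(n / (n + 1 : ℝ)) * ∑ i, x i ^ 2 := by
    simp only [Finset.sum_neg_distrib, ← Finset.mul_sum, ← Finset.sum_div, Finset.sum_add_distrib,
      Finset.sum_const, Finset.card_univ, Fintype.card_fin, nsmul_eq_mul]
    ring
  have hxx : x ⬝ᵥ x = ∑ i, x i ^ 2 := by simp [dotProduct, sq]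
  rw [hs] at hsum
  rw [hxx]
  have h0 : 0 ≤ ∑ i, x i ^ 2 := Finset.sum_nonneg fun i _ => sq_nonneg _
  have h1 : (n : ℝ) / (n + 1) ≤ 1 := by rw [div_le_one (by positivity)]; linarith
  nlinarith

/-- If `F` absorbs `𝒫`, then `F + Int 𝒫 ⊆ Int F`. -/
lemma add_interior {F : Set (SymMat n)} (hp : ∀ A ∈ F, ∀ P ∈ Psd n, A + P ∈ F)
    {A P : SymMat n} (hA : A ∈ F) (hP : P ∈ interior (Psd n)) : A + P ∈ interior F := by
  have ho : IsOpen (F + interior (Psd n)) := isOpen_interior.add_left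
  refine interior_maximal ?_ ho (Set.add_mem_add hA hP)
  rintro _ ⟨a, ha, b, hb, rfl⟩
  exact hp a ha b (interior_subset hb)

lemma smul_idm_mem {t : ℝ} (ht : 0 < t) : t • idm n ∈ interior (Psd n) := by
  have h : t • idm n ∈ t • interior (Psd n) := Set.smul_mem_smul_set idm_mem_interior
  rw [← interior_smul₀ ht.ne'] at h
  refine interior_mono ?_ h
  rintro _ ⟨A, hA, rfl⟩
  exact psd_smul hA ht.le

lemma mem_symOn {v : EuclideanSpace ℝ (Fin n)} {B : SymMat n}
    (hB : (B : Matrix (Fin n) (Fin n) ℝ) *ᵥ v.ofLp = 0) :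
    B ∈ symOn (Submodule.span ℝ {v})ᗮ := by
  set W := (Submodule.span ℝ {v})ᗮ with hW
  have hP : ∀ x, Matrix.toEuclideanLin (projMat W) x = W.starProjection x := by
    intro x
    simp only [projMat, LinearEquiv.apply_symm_apply]
    rfl
  have hsym : (Matrix.toEuclideanLin (B : Matrix (Fin n) (Fin n) ℝ)).IsSymmetric :=
    Matrix.isSymmetric_toEuclideanLin_iff.2 (isHerm B)
  have hBv : Matrix.toEuclideanLin (B : Matrix (Fin n) (Fin n) ℝ) v = 0 := by
    rw [Matrix.toEuclideanLin_apply, hB]; rfl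
  have hmul : ∀ (M N : Matrix (Fin n) (Fin n) ℝ) x, Matrix.toEuclideanLin (M * N) x =
      Matrix.toEuclideanLin M (Matrix.toEuclideanLin N x) := by
    intro M N x
    simp [Matrix.toEuclideanLin_apply, Matrix.mulVec_mulVec]
  change (B : Matrix (Fin n) (Fin n) ℝ) = projMat W * B * projMat W
  apply Matrix.toEuclideanLin.injective
  refine LinearMap.ext fun x => ?_
  rw [hmul, hmul, hP, hP]
  have h1 : Matrix.toEuclideanLin (B : Matrix (Fin n) (Fin n) ℝ) (W.starProjection x) =
      Matrix.toEuclideanLin (B : Matrix (Fin n) (Fin n) ℝ) x := by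
    have hx : x - W.starProjection x ∈ Wᗮ := W.sub_starProjection_mem_orthogonal x
    have hx' : x - W.starProjection x ∈ Submodule.span ℝ {v} := by
      have he : Wᗮ = Submodule.span ℝ {v} := Submodule.orthogonal_orthogonal _
      exact he.le hx
    rw [Submodule.mem_span_singleton] at hx'
    obtain ⟨c, hc⟩ := hx'
    have := congrArg (Matrix.toEuclideanLin (B : Matrix (Fin n) (Fin n) ℝ)) hc
    rw [map_smul, hBv, smul_zero, map_sub] at this
    exact (sub_eq_zero.1 this.symm).symm
  rw [h1]
  refine (Submodule.starProjection_eq_self_iff.2 ?_).symm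
  rw [hW, Submodule.mem_orthogonal_singleton_iff_inner_right, ← hsym, hBv, inner_zero_left]

lemma zero_mem {F : Set (SymMat n)} (hF : IsSubequation F) : (0 : SymMat n) ∈ F := by
  obtain ⟨A, hA⟩ := hF.nonempty
  simpa using hF.cone 0 le_rfl A hA

lemma psd_subset {F : Set (SymMat n)} (hF : IsSubequation F) : Psd n ⊆ F := fun P hP => by
  simpa using hF.positivity 0 (zero_mem hF) P hP

lemma add_mem_cone {F : Set (SymMat n)} (hF : IsSubequation F) {A B : SymMat n}
    (hA : A ∈ F) (hB : B ∈ F) : A + B ∈ F := by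
  have h := hF.convex hA hB (by norm_num : (0 : ℝ) ≤ 1 / 2) (by norm_num : (0 : ℝ) ≤ 1 / 2)
    (by norm_num)
  have h2 := hF.cone 2 (by norm_num) _ h
  rw [smul_add, smul_smul, smul_smul] at h2
  norm_num at h2
  exact h2

/-- The edge as a submodule. -/
def edgeSub {F : Set (SymMat n)} (hF : IsSubequation F) : Submodule ℝ (SymMat n) where
  carrier := edge F
  zero_mem' := ⟨zero_mem hF, by simpa using zero_mem hF⟩
  add_mem' := by
    rintro A B ⟨hA, hA'⟩ ⟨hB, hB'⟩
    refine ⟨add_mem_cone hF hA hB, ?_⟩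
    rw [Set.mem_neg] at *
    rw [neg_add]
    exact add_mem_cone hF hA' hB'
  smul_mem' := by
    rintro c A ⟨hA, hA'⟩
    rw [Set.mem_neg] at hA'
    rcases le_total 0 c with hc | hc
    · refine ⟨hF.cone c hc A hA, ?_⟩
      rw [Set.mem_neg, ← smul_neg]
      exact hF.cone c hc _ hA'
    · refine ⟨?_, ?_⟩
      · rw [← neg_smul_neg]
        exact hF.cone _ (neg_nonneg.2 hc) _ hA'
      · rw [Set.mem_neg, ← neg_smul]
        exact hF.cone _ (neg_nonneg.2 hc) _ hA

lemma tinner_neg_left (A B : SymMat n) : tinner (-A) B = - tinner A B := by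
  simp [tinner]

lemma tinner_add_left (A B C : SymMat n) : tinner (A + B) C = tinner A C + tinner B C := by
  simp [tinner, add_mul]

lemma polar_subset {F : Set (SymMat n)} (hF : IsSubequation F) : polarCone F ⊆ Psd n := by
  intro B hB
  rw [mem_psd]
  intro x
  have := hB _ (psd_subset hF (lineProj_mem (WithLp.toLp 2 x)))
  rwa [tinner_lineProj] at this

lemma edge_orth {F : Set (SymMat n)} {A B : SymMat n} (hA : A ∈ edge F) (hB : B ∈ polarCone F) :
    tinner A B = 0 := by
  have h1 := hB A hA.1
  have h2 := hB (-A) hA.2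
  rw [tinner_neg_left] at h2
  linarith

lemma edge_span_orth {F : Set (SymMat n)} {A B : SymMat n} (hA : A ∈ edge F)
    (hB : B ∈ Submodule.span ℝ (polarCone F)) : tinner A B = 0 := by
  have : Submodule.span ℝ (polarCone F) ≤ LinearMap.ker (tbil n A) :=
    Submodule.span_le.2 fun B hB => edge_orth hA hB
  exact this hB

lemma orth_subset_span {F : Set (SymMat n)} (hF : IsSubequation F) {B : SymMat n}
    (hB : ∀ A ∈ edge F, tinner A B = 0) : B ∈ Submodule.span ℝ (polarCone F) := by
  by_contra hn
  obtain ⟨f, hf, hle⟩ := Submodule.exists_le_ker_of_notMem hn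
  obtain ⟨A, hA⟩ := exists_rep f
  have hz : ∀ C ∈ polarCone F, tinner A C = 0 := by
    intro C hC
    rw [tinner_comm, ← hA]
    exact hle (Submodule.subset_span hC)
  have hmem : ∀ D : SymMat n, (∀ C ∈ polarCone F, tinner D C = 0) → D ∈ F := by
    intro D hD
    by_contra hDF
    obtain ⟨C, hC, hlt⟩ := separate hF.nonempty hF.isClosed hF.convex hF.cone hDF
    rw [hD C hC] at hlt
    exact lt_irrefl _ hlt
  have hE : A ∈ edge F := ⟨hmem A hz, hmem (-A) fun C hC => by
    rw [tinner_neg_left, hz C hC, neg_zero]⟩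
  apply hf
  rw [hA, tinner_comm, hB A hE]

lemma edge_psd {F : Set (SymMat n)} (hF : IsSubequation F) (hc : SymMat.IsComplete F)
    {A : SymMat n} (hA : A ∈ edge F) (hP : A ∈ Psd n) : A = 0 := by
  by_contra hne
  have hcol : ∃ x : Fin n → ℝ, (A : Matrix (Fin n) (Fin n) ℝ) *ᵥ x ≠ 0 := by
    by_contra! h
    apply hne
    apply Subtype.ext
    apply Matrix.ext_of_mulVec_single
    intro i
    rw [h]
    exact (Matrix.zero_mulVec _).symm
  obtain ⟨x, hx⟩ := hcol
  apply hc
  refine ⟨(Submodule.span ℝ {WithLp.toLp 2 ((A : Matrix (Fin n) (Fin n) ℝ) *ᵥ x)})ᗮ, ?_, ?_⟩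
  · rw [Ne, Submodule.orthogonal_eq_top_iff, Submodule.span_singleton_eq_bot]
    intro h
    exact hx (congrArg WithLp.ofLp h)
  · intro B hB
    apply mem_symOn
    have h := (trace_mul_psd hP (polar_subset hF hB)).2 (edge_orth hA hB)
    change (B : Matrix (Fin n) (Fin n) ℝ) *ᵥ ((A : Matrix (Fin n) (Fin n) ℝ) *ᵥ x) = 0
    rw [Matrix.mulVec_mulVec, h, Matrix.zero_mulVec]

end SymMat

open SymMat in
theorem minimality_criteria {n : ℕ} (F : Set (SymMat n)) (hF : IsSubequation F)
    (hc : SymMat.IsComplete F) :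
    List.TFAE [
      F = edge F + Psd n,
      interior F = edge F + interior (Psd n),
      polarCone F =
        ((Submodule.span ℝ (polarCone F) : Submodule ℝ (SymMat n)) : Set (SymMat n)) ∩ Psd n] := by
  have hclosed : IsClosed (edge F + Psd n) :=
    closed_add (edgeSub hF) fun A hA hP => edge_psd hF hc hA hP
  have hsub : edge F + Psd n ⊆ F := by
    rintro _ ⟨e, he, p, hp, rfl⟩
    exact hF.positivity e he.1 p hp
  have hsubI : edge F + interior (Psd n) ⊆ interior F := by
    rintro _ ⟨e, he, p, hp, rfl⟩
    exact add_interior hF.positivity he.1 hp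
  tfae_have 1 → 2 := by
    intro h
    refine Subset.antisymm (fun A hA => ?_) hsubI
    have hcont : Continuous fun t : ℝ => A - t • idm n := by fun_prop
    have hev : ∀ᶠ t : ℝ in nhds 0, A - t • idm n ∈ F := by
      refine hcont.tendsto 0 ?_
      simpa using mem_interior_iff_mem_nhds.1 hA
    obtain ⟨t, ht, htF⟩ := ((Filter.Eventually.filter_mono nhdsWithin_le_nhds hev).and
      (self_mem_nhdsWithin : Ioi (0 : ℝ) ∈ nhdsWithin 0 (Ioi 0))).exists
    rw [h] at ht
    obtain ⟨e, he, p, hp, hep⟩ := ht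
    refine ⟨e, he, p + t • idm n, ?_, ?_⟩
    · exact add_interior (fun _ h1 _ h2 => psd_add h1 h2) hp (smul_idm_mem htF)
    · have hep' : e + p = A - t • idm n := hep
      change e + (p + t • idm n) = A
      rw [← add_assoc, hep', sub_add_cancel]
  tfae_have 2 → 1 := by
    intro h
    refine Subset.antisymm (fun A hA => ?_) hsub
    have hcont : Continuous fun t : ℝ => A + t • idm n := by fun_prop
    have hlim : Filter.Tendsto (fun t : ℝ => A + t • idm n) (nhdsWithin 0 (Ioi 0)) (nhds A) := by
      have := hcont.tendsto 0
      simp only [zero_smul, add_zero] at this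
      exact this.mono_left nhdsWithin_le_nhds
    refine hclosed.mem_of_tendsto hlim ?_
    filter_upwards [self_mem_nhdsWithin] with t ht
    have h1 : A + t • idm n ∈ interior F := add_interior hF.positivity hA (smul_idm_mem ht)
    rw [h] at h1
    exact Set.add_subset_add_left interior_subset h1
  tfae_have 1 → 3 := by
    intro h
    refine Subset.antisymm (fun B hB => ⟨Submodule.subset_span hB, polar_subset hF hB⟩) ?_
    rintro B ⟨hBS, hBP⟩ A hA
    rw [h] at hA
    obtain ⟨e, he, p, hp, rfl⟩ := hA
    change 0 ≤ tinner (e + p) B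
    rw [tinner_add_left, edge_span_orth he hBS, zero_add]
    exact (trace_mul_psd hp hBP).1
  tfae_have 3 → 1 := by
    intro h
    refine Subset.antisymm (fun A hA => ?_) hsub
    by_contra hn
    have h0E : (0 : SymMat n) ∈ edge F := (edgeSub hF).zero_mem
    have hEP : edge F ⊆ edge F + Psd n := fun e he => ⟨e, he, 0, psd_zero, add_zero e⟩
    have hPP : Psd n ⊆ edge F + Psd n := fun p hp => ⟨0, h0E, p, hp, zero_add p⟩
    obtain ⟨B, hB, hlt⟩ := separate ⟨0, hPP psd_zero⟩ hclosed
      ((edgeSub hF).convex.add psd_convex) (by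
        rintro t ht _ ⟨e, he, p, hp, rfl⟩
        exact ⟨t • e, (edgeSub hF).smul_mem t he, t • p, psd_smul hp ht, (smul_add t e p).symm⟩) hn
    have hBP : B ∈ Psd n := by
      rw [mem_psd]
      intro x
      have := hB _ (hPP (lineProj_mem (WithLp.toLp 2 x)))
      rwa [tinner_lineProj] at this
    have hBE : ∀ e ∈ edge F, tinner e B = 0 := by
      intro e he
      have h1 := hB e (hEP he)
      have h2 := hB (-e) (hEP ((edgeSub hF).neg_mem he))
      rw [tinner_neg_left] at h2
      linarith
    have hBF : B ∈ polarCone F := by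
      rw [h]
      exact ⟨orth_subset_span hF hBE, hBP⟩
    exact absurd (hBF A hA) (not_le.2 hlt)
  tfae_finish
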